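/- Let a, b, α, β be real numbers with 0 ≤ a, b, α, β < 1, a + b ≤ 1, and α + β ≤ 1, and define f1, f2, f3 and g as in the context. Set C := 4 − a(1−α) − 3α − β(3−α−β) − b(1 − 3β + β(α+β)). Then: (i) f3(u,1) = (β−1)²(a − b − 2) ≠ 0 for every real u; (ii) C > 0; and (iii) for every real u, g(u,1) = 0 if and only if C·u = (1−β)²(1−b). Consequently the linear equation g(u,1) = 0, which characterizes the critical density p_c in the proof of Theorem 1.1, has the unique real solution u = (1−β)²(1−b)/C. -/

import Mathlib

/-- `f1(u,v)` from Proposition 2.1 of the paper. -/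
noncomputable def f1 (a b α β u v : ℝ) : ℝ :=
  u * v * (-v * (-α * a + a + α + β * (α + β) * (b * v ^ 2 - 1)
    - b * β * v * (v + 2) + b + β - 1) - 2 * (α + β - 1))

/-- `f2(u,v)` from Proposition 2.1 of the paper. -/
noncomputable def f2 (a b β u v : ℝ) : ℝ :=
  (β * v - 1) ^ 2 * (v * (a + b * (v - 1) * v - 2) - 1) + u

/-- `f3(u,v)` from Proposition 2.1 of the paper (it does not actually depend on `u`). -/
noncomputable def f3 (a b β u v : ℝ) : ℝ :=
  (β * v - 1) ^ 2 * (a + b * (v - 2) * v - 2)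

/-- `g(u,v)` from Proposition 2.1 of the paper. -/
noncomputable def g (a b α β u v : ℝ) : ℝ :=
  -v + (f1 a b α β u v + f2 a b β u v) / f3 a b β u v

/-- The constant `C` from the analysis of the linear equation `g(u,1) = 0`. -/
noncomputable def C (a b α β : ℝ) : ℝ :=
  4 - a * (1 - α) - 3 * α - β * (3 - α - β) - b * (1 - 3 * β + β * (α + β))

theorem f3_one (a b β u : ℝ) : f3 a b β u 1 = (β - 1) ^ 2 * (a - b - 2) := by
  unfold f3
  ring

theorem f1_add_f2_one (a b α β u : ℝ) :
    f1 a b α β u 1 + f2 a b β u 1 = C a b α β * u + (β - 1) ^ 2 * (a - 3) := by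
  unfold f1 f2 C
  ring

/-- `C` is affine in `(a, b)`; it is positive at the three vertices of the simplex. -/
theorem C_pos {a b α β : ℝ} (ha : 0 ≤ a) (hb : 0 ≤ b) (hab : a + b ≤ 1)
    (hα0 : 0 ≤ α) (hα1 : α < 1) (hβ : 0 ≤ β) (hαβ : α + β ≤ 1) : 0 < C a b α β := by
  have h_origin : 0 < 4 - 3 * (α + β) + β * (α + β) := by nlinarith
  have h_left : 0 < 3 + α - 3 * (α + β) + β * (α + β) := by
    nlinarith [mul_nonneg hα0 (sub_nonneg.2 hαβ), sq_nonneg (2 * (α + β) - 3)]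
  have h_right : 0 < 3 - 3 * α := by linarith
  have h_combination : C a b α β = (1 - a - b) * (4 - 3 * (α + β) + β * (α + β))
      + a * (3 + α - 3 * (α + β) + β * (α + β)) + b * (3 - 3 * α) := by
    unfold C
    ring
  rw [h_combination]
  rcases ha.eq_or_lt with rfl | ha
  · rcases hb.eq_or_lt with rfl | hb
    · linarith
    · have := mul_nonneg (show 0 ≤ 1 - 0 - b by linarith) h_origin.le
      have := mul_pos hb h_right
      linarith
  · have := mul_nonneg (show 0 ≤ 1 - a - b by linarith) h_origin.le
    have := mul_pos ha h_left
    have := mul_nonneg hb h_right.le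
    linarith

theorem g_one_eq_zero_iff {a b α β u : ℝ} (h : f3 a b β u 1 ≠ 0) :
    g a b α β u 1 = 0 ↔ C a b α β * u = (1 - β) ^ 2 * (1 - b) := by
  rw [g, neg_add_eq_zero, eq_comm, div_eq_one_iff_eq h, f1_add_f2_one, f3_one]
  constructor <;> intro h <;> linear_combination h

/-- The linear equation `g(u,1) = 0` characterizing the critical density `p_c` in the
proof of Theorem 1.1: `f3(u,1)` is the nonzero constant `(β−1)²(a−b−2)`, the constant
`C` is strictly positive, `g(u,1) = 0` iff `C·u = (1−β)²(1−b)`, and consequently the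
equation has the unique real solution `u = (1−β)²(1−b)/C`. -/
theorem critical_density_linear_equation (a b α β : ℝ)
    (ha0 : 0 ≤ a) (ha1 : a < 1) (hb0 : 0 ≤ b) (hb1 : b < 1)
    (hα0 : 0 ≤ α) (hα1 : α < 1) (hβ0 : 0 ≤ β) (hβ1 : β < 1)
    (hab : a + b ≤ 1) (hαβ : α + β ≤ 1) :
    (∀ u : ℝ, f3 a b β u 1 = (β - 1) ^ 2 * (a - b - 2) ∧ f3 a b β u 1 ≠ 0) ∧
    0 < C a b α β ∧
    (∀ u : ℝ, g a b α β u 1 = 0 ↔ C a b α β * u = (1 - β) ^ 2 * (1 - b)) ∧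
    (∀ u : ℝ, g a b α β u 1 = 0 ↔ u = (1 - β) ^ 2 * (1 - b) / C a b α β) := by
  have hf3 : ∀ u : ℝ, f3 a b β u 1 ≠ 0 := fun u => by
    rw [f3_one]
    exact mul_ne_zero (pow_ne_zero 2 (by linarith)) (by linarith)
  have hC := C_pos ha0 hb0 hab hα0 hα1 hβ0 hαβ
  refine ⟨fun u => ⟨f3_one a b β u, hf3 u⟩, hC, fun u => g_one_eq_zero_iff (hf3 u), fun u => ?_⟩
  rw [g_one_eq_zero_iff (hf3 u), eq_div_iff hC.ne', mul_comm]
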